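/- There do not exist Borel maps φ : [ω]^ω → ([ω]^ω)^ℕ and ψ : [ω]^ω → [ω]^ω satisfying: (a) the family ψ([ω]^ω) is centered, and (b) for all A, B ∈ [ω]^ω, if A ⊆* ψ(B) then there exists n ∈ ℕ such that B does not split the n-th component φ(A)(n). (I.e., there is no Borel Tukey morphism from the σ-splitting number 𝔰_σ to the pseudo-intersection number 𝔭.) -/

import Mathlib

open Filter

/-- The subset of ℕ coded by an element of Cantor space. -/
def bset (x : ℕ → Bool) : Set ℕ := {n | x n = true}

/-- `[ω]^ω`, regarded as a subspace of Cantor space via characteristic functions. -/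
abbrev InfC := {x : ℕ → Bool // (bset x).Infinite}

/-- `A ⊆* B`: `A ∖ B` is finite. -/
def SubStar (A B : Set ℕ) : Prop := (A \ B).Finite

/-- `B` splits `A`: both `A ∩ B` and `A ∖ B` are infinite. -/
def SplitsSet (B A : Set ℕ) : Prop := (A ∩ B).Infinite ∧ (A \ B).Infinite

/-- A family of infinite sets is centered iff every nonempty finite subfamily
has infinite intersection. -/
def Centered (F : Set InfC) : Prop :=
  ∀ s : Finset InfC, ↑s ⊆ F → s.Nonempty → (⋂ x ∈ s, bset x.1).Infinite

open Topology

namespace BT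

/-- Cantor space. -/
abbrev Y := ℕ → Bool
/-- Sequences of instructions: a constraint code and an optional pick. -/
abbrev W := ℕ → ℕ × ℕ
/-- The space of pairs. -/
abbrev Z := Y × W

lemma exists_cyl {E : Type*} [TopologicalSpace E] [DiscreteTopology E] {O : Set (ℕ → E)}
    (hO : IsOpen O) {x : ℕ → E} (hx : x ∈ O) : ∃ k, PiNat.cylinder x k ⊆ O := by
  have hb := PiNat.isTopologicalBasis_cylinders (fun _ : ℕ => E)
  obtain ⟨v, ⟨y, n, rfl⟩, hxv, hv⟩ := hb.exists_subset_of_mem_open hx hO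
  refine ⟨n, ?_⟩
  rwa [PiNat.mem_cylinder_iff_eq.1 hxv]

lemma exists_cylZ {O : Set Z} (hO : IsOpen O) {z : Z} (hz : z ∈ O) :
    ∃ k, PiNat.cylinder z.1 k ×ˢ PiNat.cylinder z.2 k ⊆ O := by
  obtain ⟨u, v, hu, hv, h1, h2, h⟩ := isOpen_prod_iff.1 hO z.1 z.2 hz
  obtain ⟨k1, hk1⟩ := exists_cyl hu h1
  obtain ⟨k2, hk2⟩ := exists_cyl hv h2
  refine ⟨max k1 k2, fun w hw => h ⟨hk1 ?_, hk2 ?_⟩⟩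
  · exact PiNat.cylinder_anti _ (le_max_left _ _) hw.1
  · exact PiNat.cylinder_anti _ (le_max_right _ _) hw.2

instance borelW : BorelSpace W := by
  have : BorelSpace (ℕ × ℕ) := inferInstance
  exact Pi.borelSpace

instance borelY : BorelSpace Y := Pi.borelSpace

instance borelZ : BorelSpace Z := Prod.borelSpace

/-- localisation of nonmeager Borel covers -/
lemma localize {X : Type*} [TopologicalSpace X] [BaireSpace X] [MeasurableSpace X] [BorelSpace X]
    {ι : Type*} [Countable ι] {S : ι → Set X} (hS : ∀ i, MeasurableSet (S i))
    {V : Set X} (hV : IsOpen V) (hne : V.Nonempty)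
    (h : ∀ᶠ z in residual X, z ∈ V → ∃ i, z ∈ S i) :
    ∃ i, ∃ U ⊆ V, IsOpen U ∧ U.Nonempty ∧ ∀ᶠ z in residual X, z ∈ U → z ∈ S i := by
  choose O hO hSO using fun i => (hS i).residualEq_isOpen
  by_contra hcon
  have hemp : ∀ i, O i ∩ V = ∅ := by
    intro i
    by_contra hne'
    refine hcon ⟨i, O i ∩ V, Set.inter_subset_right, (hO i).inter hV,
      Set.nonempty_iff_ne_empty.2 hne', ?_⟩
    filter_upwards [Filter.eventuallyEq_set.1 (hSO i)] with z hz hzz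
    exact hz.2 hzz.1
  have hall : ∀ᶠ z in residual X, ∀ i, (z ∈ S i ↔ z ∈ O i) :=
    eventually_countable_forall.2 fun i => Filter.eventuallyEq_set.1 (hSO i)
  have hd : Dense {z | z ∉ V} := by
    apply dense_of_mem_residual
    filter_upwards [h, hall] with z h1 h2 hzV
    obtain ⟨i, hi⟩ := h1 hzV
    have : z ∈ O i ∩ V := ⟨(h2 i).1 hi, hzV⟩
    rw [hemp i] at this
    exact this
  obtain ⟨z, hz1, hz2⟩ := hd.inter_open_nonempty V hV hne
  exact hz2 hz1

lemma resid_invol {X : Type*} [TopologicalSpace X] {T : X → X} (hc : Continuous T)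
    (hi : Function.Involutive T) : Tendsto T (residual X) (residual X) := by
  let h : X ≃ₜ X := ⟨hi.toPerm, hc, hc⟩
  exact tendsto_residual_of_isOpenMap h.continuous h.isOpenMap

lemma exists_codes : ∃ D : ℕ → Y, (∃ c, ∀ q, D c q = false) ∧
    ∀ l, ∃ e : ℕ → ℕ, Function.Involutive e ∧
      ∀ c q, D (e c) q = xor (D c q) (decide (l ≤ q)) := by
  let E : Finset ℕ × Bool ≃ ℕ := (nonempty_equiv_of_countable (α := Finset ℕ × Bool) (β := ℕ)).some
  refine ⟨fun c q => xor (decide (q ∈ (E.symm c).1)) (E.symm c).2, ⟨E (∅, false), by simp⟩, ?_⟩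
  intro l
  refine ⟨fun c => E (symmDiff (E.symm c).1 (Finset.range l), !(E.symm c).2), ?_, ?_⟩
  · intro c
    simp
  · intro c q
    simp only [Equiv.symm_apply_apply, Finset.mem_symmDiff, Finset.mem_range]
    by_cases h1 : q ∈ (E.symm c).1 <;> by_cases h2 : l ≤ q <;> cases (E.symm c).2 <;>
      simp [h1, h2] <;> omega

/-- Pointwise xor. -/
def xr (a b : Y) : Y := fun q => xor (a q) (b q)

/-- flip beyond `l` -/
def fl (l : ℕ) : Y := fun q => decide (l ≤ q)

/-- The set built following the instructions. -/
def aset (D : ℕ → Y) (ψ : Y → Y) (z : Z) : Set ℕ :=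
  {p | ∃ j, (z.2 j).2 = p + 1 ∧ ∀ i < j, ψ (xr (D (z.2 i).1) z.1) p = true}

open Classical in
/-- Its characteristic function. -/
noncomputable def achar (D : ℕ → Y) (ψ : Y → Y) (z : Z) : Y := fun p => decide (p ∈ aset D ψ z)

lemma meas_xr (a : Y) : Measurable (xr a) := by
  refine measurable_pi_lambda _ fun q => ?_
  exact (Measurable.of_discrete (f := fun b => xor (a q) b)).comp (measurable_pi_apply q)

lemma cont_xr (a : Y) : Continuous (xr a) := by
  refine continuous_pi fun q => ?_
  exact (continuous_of_discreteTopology (f := fun b => xor (a q) b)).comp (continuous_apply q)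

lemma meas_constraint {D : ℕ → Y} {ψ : Y → Y} (hψ : Measurable ψ) (p i : ℕ) :
    MeasurableSet {z : Z | ψ (xr (D (z.2 i).1) z.1) p = true} := by
  have : {z : Z | ψ (xr (D (z.2 i).1) z.1) p = true} =
      ⋃ c : ℕ, {z : Z | (z.2 i).1 = c} ∩ {z : Z | ψ (xr (D c) z.1) p = true} := by
    ext z; simp
  rw [this]
  refine MeasurableSet.iUnion fun c => MeasurableSet.inter ?_ ?_
  · have : Measurable (fun z : Z => (z.2 i).1) := by fun_prop
    exact this (measurableSet_singleton c)
  · have : Measurable (fun z : Z => ψ (xr (D c) z.1) p) :=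
      (measurable_pi_apply p).comp (hψ.comp ((meas_xr _).comp measurable_fst))
    exact this (measurableSet_singleton true)

lemma meas_mem_aset {D : ℕ → Y} {ψ : Y → Y} (hψ : Measurable ψ) (p : ℕ) :
    MeasurableSet {z : Z | p ∈ aset D ψ z} := by
  have : {z : Z | p ∈ aset D ψ z} = ⋃ j : ℕ, {z : Z | (z.2 j).2 = p + 1} ∩
      ⋂ i : ℕ, ⋂ _ : i < j, {z : Z | ψ (xr (D (z.2 i).1) z.1) p = true} := by
    ext z; simp [aset]
  rw [this]
  refine MeasurableSet.iUnion fun j => MeasurableSet.inter ?_ ?_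
  · have : Measurable (fun z : Z => (z.2 j).2) := by fun_prop
    exact this (measurableSet_singleton (p + 1))
  · exact MeasurableSet.iInter fun i => MeasurableSet.iInter fun _ => meas_constraint hψ p i

lemma meas_achar {D : ℕ → Y} {ψ : Y → Y} (hψ : Measurable ψ) : Measurable (achar D ψ) := by
  refine measurable_pi_lambda _ fun p => ?_
  refine measurable_to_bool ?_
  convert meas_mem_aset (D := D) hψ p using 1
  ext z; simp [achar]

/-- any number of values has infinite intersection -/
def Cent (ψ : Y → Y) : Prop :=
  ∀ (k : ℕ) (b : ℕ → Y), {p | ∀ i < k, ψ (b i) p = true}.Infinite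

lemma aset_infinite {D : ℕ → Y} {ψ : Y → Y} (hψ : Measurable ψ) (hc : Cent ψ) :
    ∀ᶠ z in residual Z, (aset D ψ z).Infinite := by
  simp_rw [Set.infinite_iff_exists_gt]
  refine eventually_countable_forall.2 fun N => ?_
  have hm : MeasurableSet {z : Z | ¬ ∃ b ∈ aset D ψ z, N < b} := by
    have : {z : Z | ¬ ∃ b ∈ aset D ψ z, N < b} =
        (⋃ b : ℕ, ⋃ _ : N < b, {z : Z | b ∈ aset D ψ z})ᶜ := by
      ext z; simp; grind
    rw [this]
    exact (MeasurableSet.iUnion fun b => MeasurableSet.iUnion fun _ => meas_mem_aset hψ b).compl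
  obtain ⟨O, hO, hSO⟩ := hm.residualEq_isOpen
  have hSO := Filter.eventuallyEq_set.1 hSO
  rcases O.eq_empty_or_nonempty with rfl | ⟨z, hz⟩
  · filter_upwards [hSO] with z hz
    by_contra hcon
    exact hz.1 hcon
  exfalso
  obtain ⟨k, hk⟩ := exists_cylZ hO hz
  let v : W := fun i => if i < k then z.2 i else (0, 0)
  let T : ℕ → Z → Z := fun p w => (w.1, fun i =>
    if i = k then ((w.2 i).1, Equiv.swap 0 (p + 1) (w.2 i).2) else w.2 i)
  have hTc : ∀ p, Continuous (T p) := by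
    intro p
    refine continuous_fst.prodMk (continuous_pi fun i => ?_)
    by_cases h : i = k
    · simp only [h, if_true]
      exact (continuous_of_discreteTopology
        (f := fun a : ℕ × ℕ => (a.1, Equiv.swap 0 (p + 1) a.2))).comp
        ((continuous_apply k).comp continuous_snd)
    · simp only [h, if_false]
      exact (continuous_apply i).comp continuous_snd
  have hTi : ∀ p, Function.Involutive (T p) := by
    intro p w
    refine Prod.ext rfl (funext fun i => ?_)
    by_cases h : i = k
    · simp [T, h]
    · simp [T, h]
  have hall : ∀ᶠ w in residual Z, ∀ p, (T p w ∈ {z : Z | ¬ ∃ b ∈ aset D ψ z, N < b} ↔ T p w ∈ O) :=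
    eventually_countable_forall.2 fun p => (resid_invol (hTc p) (hTi p)).eventually hSO
  obtain ⟨w, hw, hwa⟩ := (dense_of_mem_residual hall).inter_open_nonempty
    (PiNat.cylinder z.1 k ×ˢ PiNat.cylinder v (k + 1))
    ((PiNat.isOpen_cylinder _ _ _).prod (PiNat.isOpen_cylinder _ _ _))
    ⟨(z.1, v), PiNat.self_mem_cylinder _ _, PiNat.self_mem_cylinder _ _⟩
  have hw2 := PiNat.mem_cylinder_iff.1 hw.2
  obtain ⟨p, hp, hNp⟩ := Set.infinite_iff_exists_gt.1 (hc k fun i => xr (D (z.2 i).1) w.1) N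
  have hlt : ∀ i < k, w.2 i = z.2 i := fun i hi => by
    rw [hw2 i (by omega)]; simp [v, hi]
  have hTO : T p w ∈ O := by
    refine hk ⟨hw.1, PiNat.mem_cylinder_iff.2 fun i hi => ?_⟩
    simp [T, hi.ne, hlt i hi]
  refine (hwa p).2 hTO ⟨p, ⟨k, ?_, ?_⟩, hNp⟩
  · have : w.2 k = (0, 0) := by rw [hw2 k (by omega)]; simp [v]
    simp [T, this]
  · intro i hi
    have := hp i hi
    simpa [T, hi.ne, hlt i hi] using this

lemma ev_B_infinite : ∀ᶠ z in residual Z, (bset z.1).Infinite := by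
  simp_rw [Set.infinite_iff_exists_gt]
  refine eventually_countable_forall.2 fun N => residual_of_dense_open ?_ ?_
  · have : {z : Z | ∃ b ∈ bset z.1, N < b} = ⋃ b : ℕ, ⋃ _ : N < b, {z : Z | z.1 b = true} := by
      ext z; simp [bset]; grind
    change IsOpen {z : Z | ∃ b ∈ bset z.1, N < b}
    rw [this]
    refine isOpen_iUnion fun b => isOpen_iUnion fun _ => ?_
    have hcb : Continuous (fun z : Z => z.1 b) := (continuous_apply b).comp continuous_fst
    exact (isOpen_discrete {true}).preimage hcb
  · refine dense_iff_inter_open.2 fun O hO ⟨z, hz⟩ => ?_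
    obtain ⟨k, hk⟩ := exists_cylZ hO hz
    refine ⟨(fun i => if i < k then z.1 i else true, z.2), hk ⟨?_, PiNat.self_mem_cylinder _ _⟩,
      N + k + 1, ?_, by omega⟩
    · exact PiNat.mem_cylinder_iff.2 fun i hi => by simp [hi]
    · simp [bset]; omega

lemma ev_code (c : ℕ) : ∀ᶠ z in residual Z, ∃ i, (z.2 i).1 = c := by
  refine residual_of_dense_open ?_ ?_
  · have : {z : Z | ∃ i, (z.2 i).1 = c} = ⋃ i : ℕ, {z : Z | (z.2 i).1 = c} := by
      ext z; simp
    change IsOpen {z : Z | ∃ i, (z.2 i).1 = c}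
    rw [this]
    refine isOpen_iUnion fun b => ?_
    exact (isOpen_discrete {c}).preimage
      (continuous_fst.comp ((continuous_apply b).comp continuous_snd))
  · refine dense_iff_inter_open.2 fun O hO ⟨z, hz⟩ => ?_
    obtain ⟨k, hk⟩ := exists_cylZ hO hz
    refine ⟨(z.1, fun i => if i < k then z.2 i else (c, 0)),
      hk ⟨PiNat.self_mem_cylinder _ _, ?_⟩, k, by simp⟩
    exact PiNat.mem_cylinder_iff.2 fun i hi => by simp [hi]

lemma aset_subStar {D : ℕ → Y} {ψ : Y → Y} {c : ℕ} (hD : ∀ q, D c q = false) {z : Z}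
    (hz : ∃ i, (z.2 i).1 = c) : (aset D ψ z \ bset (ψ z.1)).Finite := by
  obtain ⟨i, hi⟩ := hz
  refine ((Set.finite_Iic i).image fun j => (z.2 j).2 - 1).subset ?_
  rintro p ⟨⟨j, hj, hjj⟩, hp⟩
  refine ⟨j, ?_, by simp [hj]⟩
  by_contra hcon
  have := hjj i (by simpa using hcon)
  rw [hi] at this
  have hx : xr (D c) z.1 = z.1 := by funext q; simp [xr, hD]
  rw [hx] at this
  exact hp this

theorem core (φ : Y → ℕ → Y) (ψ : Y → Y) (hφ : Measurable φ) (hψ : Measurable ψ) (hc : Cent ψ)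
    (hinf : ∀ A n, (bset (φ A n)).Infinite)
    (h : ∀ A B : Y, (bset A).Infinite → (bset B).Infinite → SubStar (bset A) (bset (ψ B)) →
      ∃ n, ¬ SplitsSet (bset B) (bset (φ A n))) : False := by
  obtain ⟨D, ⟨c0, hc0⟩, hD⟩ := exists_codes
  have hbA : ∀ z, bset (achar D ψ z) = aset D ψ z := by
    intro z; ext p; simp [bset, achar]
  let Q : ℕ × ℕ × Bool → Set Z := fun r =>
    {z | ∀ q, r.2.1 ≤ q → φ (achar D ψ z) r.1 q = true → z.1 q = r.2.2}
  have hQ : ∀ r, MeasurableSet (Q r) := by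
    intro r
    have : Q r = ⋂ q : ℕ, ⋂ _ : r.2.1 ≤ q,
        ({z : Z | φ (achar D ψ z) r.1 q = true}ᶜ ∪ {z : Z | z.1 q = r.2.2}) := by
      ext z; simp [Q, imp_iff_not_or]
    rw [this]
    refine MeasurableSet.iInter fun q => MeasurableSet.iInter fun _ =>
      MeasurableSet.union (MeasurableSet.compl ?_) ?_
    · have : Measurable (fun z : Z => φ (achar D ψ z) r.1 q) :=
        (measurable_pi_apply q).comp ((measurable_pi_apply r.1).comp
          (hφ.comp (meas_achar hψ)))
      exact this (measurableSet_singleton true)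
    · have : Measurable (fun z : Z => z.1 q) := by fun_prop
      exact this (measurableSet_singleton _)
  have hcover : ∀ᶠ z in residual Z, z ∈ (Set.univ : Set Z) → ∃ r, z ∈ Q r := by
    filter_upwards [aset_infinite (D := D) hψ hc, ev_B_infinite, ev_code c0] with z h1 h2 h3 _
    obtain ⟨n, hn⟩ := h (achar D ψ z) z.1 (by rwa [hbA]) h2 (by
      rw [hbA]; exact aset_subStar hc0 h3)
    rw [SplitsSet, not_and_or, Set.not_infinite, Set.not_infinite] at hn
    rcases hn with hn | hn
    · obtain ⟨m, hm⟩ := hn.bddAbove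
      refine ⟨(n, m + 1, false), fun q hq hq2 => ?_⟩
      by_contra hcon
      have := hm ⟨hq2, by simpa [bset] using hcon⟩
      simp only at hq
      omega
    · obtain ⟨m, hm⟩ := hn.bddAbove
      refine ⟨(n, m + 1, true), fun q hq hq2 => ?_⟩
      by_contra hcon
      have := hm ⟨hq2, by simpa [bset] using hcon⟩
      simp only at hq
      omega
  obtain ⟨⟨n, m, b⟩, U, -, hU, ⟨⟨t, u⟩, htu⟩, hUQ⟩ :=
    localize hQ isOpen_univ Set.univ_nonempty hcover
  obtain ⟨k, hk⟩ := exists_cylZ hU htu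
  simp only at hk
  -- decisions
  let f : Y → (Fin k × Fin k → Bool) := fun B r => ψ (xr (D (u r.2).1) B) ((u r.1).2 - 1)
  have hf : Measurable f := measurable_pi_lambda _ fun r =>
    (measurable_pi_apply _).comp (hψ.comp (meas_xr _))
  obtain ⟨d, U', hU't, hU', ⟨t', ht'⟩, hdec⟩ := localize (S := fun d => f ⁻¹' {d})
    (fun d => hf (measurableSet_singleton d)) (PiNat.isOpen_cylinder (fun _ => Bool) t k)
    ⟨t, PiNat.self_mem_cylinder _ _⟩ (Eventually.of_forall fun B _ => ⟨f B, rfl⟩)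
  obtain ⟨l, hl⟩ := exists_cyl hU' ht'
  obtain ⟨e, hei, hed⟩ := hD l
  have hdecZ : ∀ᶠ z in residual Z, z.1 ∈ U' → f z.1 = d :=
    (tendsto_residual_of_isOpenMap continuous_fst isOpenMap_fst).eventually hdec
  let T : Z → Z := fun w => (xr (fl l) w.1, fun i =>
    if 2 * k ≤ i then (e (w.2 i).1, (w.2 i).2) else w.2 i)
  have hTc : Continuous T := by
    refine ((cont_xr _).comp continuous_fst).prodMk (continuous_pi fun i => ?_)
    by_cases h : 2 * k ≤ i
    · simp only [h, if_true]
      exact (continuous_of_discreteTopology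
        (f := fun a : ℕ × ℕ => (e a.1, a.2))).comp
        ((continuous_apply i).comp continuous_snd)
    · simp only [h, if_false]
      exact (continuous_apply i).comp continuous_snd
  have hTi : Function.Involutive T := by
    intro w
    refine Prod.ext (funext fun q => ?_) (funext fun i => ?_)
    · simp [T, xr]
    · by_cases h : 2 * k ≤ i
      · simp [T, h, hei (w.2 i).1]
      · simp [T, h]
  have hTt := resid_invol hTc hTi
  let v : W := fun i => if i < k then u i else (e (u (i - k)).1, 0)
  obtain ⟨z, hzV, hz1, hz2, hz3, hz4⟩ := (dense_of_mem_residual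
    (hUQ.and ((hTt.eventually hUQ).and (hdecZ.and (hTt.eventually hdecZ))))).inter_open_nonempty
    (PiNat.cylinder t' l ×ˢ PiNat.cylinder v (2 * k))
    ((PiNat.isOpen_cylinder _ _ _).prod (PiNat.isOpen_cylinder _ _ _))
    ⟨(t', v), PiNat.self_mem_cylinder _ _, PiNat.self_mem_cylinder _ _⟩
  have hzB := PiNat.mem_cylinder_iff.1 hzV.1
  have hzx := PiNat.mem_cylinder_iff.1 hzV.2
  have hU1 : z.1 ∈ U' := hl hzV.1
  have hU2 : (T z).1 ∈ U' := hl (PiNat.mem_cylinder_iff.2 fun i hi => by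
    simp [T, xr, fl, hi.not_ge, hzB i hi])
  have hxu : ∀ i < k, z.2 i = u i := fun i hi => by
    rw [hzx i (by omega)]; simp [v, hi]
  have hxe : ∀ i < k, z.2 (k + i) = (e (u i).1, 0) := fun i hi => by
    rw [hzx (k + i) (by omega)]; simp [v]
  have hT2lt : ∀ i < 2 * k, (T z).2 i = z.2 i := fun i hi => by simp [T, hi.not_ge]
  have hT2ge : ∀ i, 2 * k ≤ i → (T z).2 i = (e (z.2 i).1, (z.2 i).2) := fun i hi => by
    simp [T, hi]
  have hzU : z ∈ U := hk ⟨hU't hU1, PiNat.mem_cylinder_iff.2 hxu⟩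
  have hTzU : T z ∈ U := hk ⟨hU't hU2, PiNat.mem_cylinder_iff.2 fun i hi => by
    rw [hT2lt i (by omega), hxu i hi]⟩
  have hff : f (T z).1 = f z.1 := (hz4 hU2).trans (hz3 hU1).symm
  have key1 : ∀ c, xr (D (e c)) (T z).1 = xr (D c) z.1 := by
    intro c; funext q
    simp only [xr, T, fl, hed]
    cases D c q <;> cases z.1 q <;> cases decide (l ≤ q) <;> rfl
  have key2 : ∀ c, xr (D c) (T z).1 = xr (D (e c)) z.1 := by
    intro c; rw [← key1, hei]
  have hA : aset D ψ (T z) = aset D ψ z := by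
    ext p
    refine exists_congr fun j => ?_
    rcases lt_or_ge j k with hj | hj
    · rw [hT2lt j (by omega), hxu j hj]
      refine and_congr_right fun hp => forall₂_congr fun i hi => ?_
      have := congrFun hff (⟨j, hj⟩, ⟨i, hi.trans hj⟩)
      simp only [f, hp, Nat.add_sub_cancel] at this
      rw [hT2lt i (by omega), hxu i (by omega), this]
    rcases lt_or_ge j (2 * k) with hj2 | hj2
    · have h0 : (z.2 j).2 = 0 := by
        have := hxe (j - k) (by omega)
        rw [Nat.add_sub_cancel' hj] at this
        rw [this]
      rw [hT2lt j hj2, h0]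
      simp
    · rw [hT2ge j hj2]
      refine and_congr_right fun hp => ?_
      have c1 : ∀ i < k, xr (D ((T z).2 i).1) (T z).1 = xr (D (z.2 (k + i)).1) z.1 := by
        intro i hi
        rw [hT2lt i (by omega), hxu i hi, hxe i hi, key2]
      have c2 : ∀ i < k, xr (D ((T z).2 (k + i)).1) (T z).1 = xr (D (z.2 i).1) z.1 := by
        intro i hi
        rw [hT2lt (k + i) (by omega), hxu i hi, hxe i hi, key1]
      have c3 : ∀ i, 2 * k ≤ i → xr (D ((T z).2 i).1) (T z).1 = xr (D (z.2 i).1) z.1 := by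
        intro i hi
        rw [hT2ge i hi, key1]
      constructor
      · intro H i hi
        rcases lt_or_ge i k with h1 | h1
        · rw [← c2 i h1]; exact H _ (by omega)
        rcases lt_or_ge i (2 * k) with h2 | h2
        · obtain ⟨i', rfl⟩ := Nat.exists_eq_add_of_le h1
          rw [← c1 i' (by omega)]; exact H _ (by omega)
        · rw [← c3 i h2]; exact H _ hi
      · intro H i hi
        rcases lt_or_ge i k with h1 | h1
        · rw [c1 i h1]; exact H _ (by omega)
        rcases lt_or_ge i (2 * k) with h2 | h2
        · obtain ⟨i', rfl⟩ := Nat.exists_eq_add_of_le h1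
          rw [c2 i' (by omega)]; exact H _ (by omega)
        · rw [c3 i h2]; exact H _ hi
  have hAc : achar D ψ (T z) = achar D ψ z := by
    funext p; simp [achar, hA]
  have q1 := hz1 hzU
  have q2 := hz2 hTzU
  obtain ⟨q, hq, hlq⟩ := Set.infinite_iff_exists_gt.1 (hinf (achar D ψ z) n) (m + l)
  have e1 := q1 q (show m ≤ q by omega) hq
  have e2 := q2 q (show m ≤ q by omega) (by rw [hAc]; exact hq)
  have e3 : (T z).1 q = !(z.1 q) := by
    have : l ≤ q := by omega
    simp [T, xr, fl, this]
  rw [e3, e1] at e2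
  simp at e2

lemma meas_inf : MeasurableSet {B : Y | (bset B).Infinite} := by
  have : {B : Y | (bset B).Infinite} = ⋂ N : ℕ, ⋃ b : ℕ, ⋃ _ : N < b, {B : Y | B b = true} := by
    ext B; simp [Set.infinite_iff_exists_gt, bset, and_comm]
  rw [this]
  refine MeasurableSet.iInter fun N => MeasurableSet.iUnion fun b => MeasurableSet.iUnion fun _ => ?_
  have hmb : Measurable (fun B : Y => B b) := measurable_pi_apply b
  exact hmb (measurableSet_singleton true)

lemma inf_true : (bset (fun _ => true)).Infinite := by
  have : bset (fun _ => true) = Set.univ := by ext; simp [bset]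
  rw [this]; exact Set.infinite_univ

open Classical in
/-- Extend to all of Cantor space. -/
noncomputable def ex (B : Y) : InfC :=
  ⟨if (bset B).Infinite then B else fun _ => true, by
    split_ifs with h
    · exact h
    · exact inf_true⟩

lemma meas_ex : Measurable ex :=
  Measurable.subtype_mk (Measurable.ite meas_inf measurable_id measurable_const)

lemma ex_eq {B : Y} (h : (bset B).Infinite) : ex B = ⟨B, h⟩ := by
  apply Subtype.ext; simp [ex, h]

end BT

/-- There are no Borel maps `φ : [ω]^ω → ([ω]^ω)^ℕ` and `ψ : [ω]^ω → [ω]^ω`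
with (a) `ψ([ω]^ω)` centered and (b) `A ⊆* ψ(B)` implies some component `φ(A)(n)`
is not split by `B`.  (No Borel Tukey morphism from 𝔰_σ to 𝔭.) -/
theorem stmt3 :
    ¬ ∃ (φ : InfC → (ℕ → InfC)) (ψ : InfC → InfC),
      Measurable φ ∧ Measurable ψ ∧
      Centered (Set.range ψ) ∧
      ∀ A B : InfC, SubStar (bset A.1) (bset (ψ B).1) →
        ∃ n : ℕ, ¬ SplitsSet (bset B.1) (bset (φ A n).1) := by
  classical
  rintro ⟨φ, ψ, hφ, hψ, hc, h⟩
  refine BT.core (fun A n => (φ (BT.ex A) n).1) (fun B => (ψ (BT.ex B)).1) ?_ ?_ ?_ ?_ ?_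
  · refine measurable_pi_lambda _ fun n => ?_
    exact measurable_subtype_coe.comp ((measurable_pi_apply n).comp (hφ.comp BT.meas_ex))
  · exact measurable_subtype_coe.comp (hψ.comp BT.meas_ex)
  · intro k b
    have := hc ((Finset.range (k + 1)).image fun i => ψ (BT.ex (b i))) (by
      intro x hx
      simp only [Finset.coe_image, Set.mem_image] at hx
      obtain ⟨i, -, rfl⟩ := hx
      exact ⟨_, rfl⟩) (by simp)
    refine this.mono fun p hp i hi => ?_
    simp only [Set.mem_iInter] at hp
    exact hp (ψ (BT.ex (b i))) (Finset.mem_image.2 ⟨i, by simp; omega, rfl⟩)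
  · intro A n
    exact (φ (BT.ex A) n).2
  · intro A B hA hB hs
    simp only [BT.ex_eq hA, BT.ex_eq hB] at hs ⊢
    exact h ⟨A, hA⟩ ⟨B, hB⟩ hs
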